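/- arXiv:0807.1131 — 2 statements merged into one kernel-verified Lean document; each statement's English description precedes it below -/
import Mathlib

section
/- Let ABC be a non-equilateral triangle with incenter I. Then the Brocard axes of the triangles IBC, ICA, IAB all pass through the Kimberling center X₅₈ of triangle ABC, the isogonal conjugate of the Spieker point. -/
open EuclideanGeometry RealInnerProductSpace Real

noncomputable section

/-- The Euclidean plane. -/
abbrev Pt := EuclideanSpace ℝ (Fin 2)

/-- The point with homogeneous barycentric coordinates `(x : y : z)` with respect to `A B C`. -/
def bary (A B C : Pt) (x y z : ℝ) : Pt := (x + y + z)⁻¹ • (x • A + y • B + z • C)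

/-- The incenter of triangle `ABC`, with barycentric coordinates `(a : b : c)`. -/
def incenterPt (A B C : Pt) : Pt := bary A B C (dist B C) (dist C A) (dist A B)

/-- The centroid of triangle `ABC`. -/
def centroidPt (A B C : Pt) : Pt := bary A B C 1 1 1

/-- The power of a point `p` with respect to a circle `s`. -/
def spow (s : Sphere Pt) (p : Pt) : ℝ := dist p s.center ^ 2 - s.radius ^ 2

/-- The radical axis of two circles: the locus of points of equal power. -/
def radAxis (s t : Sphere Pt) : Set Pt := {p | spow s p = spow t p}

/-- Three circles are coaxal if the radical axes of all pairs coincide. -/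
def Coaxal (s t u : Sphere Pt) : Prop := radAxis s t = radAxis t u ∧ radAxis t u = radAxis s u

/-- The isogonal-conjugate image (with respect to triangle `ABC`) of a set `L`:
for `L` a line this is the circumconic that is the isogonal conjugate of `L`. -/
def isogSet (A B C : Pt) (L : Set Pt) : Set Pt :=
  {S | ∃ p q r : ℝ, p ≠ 0 ∧ q ≠ 0 ∧ r ≠ 0 ∧ p + q + r ≠ 0 ∧
    dist B C ^ 2 / p + dist C A ^ 2 / q + dist A B ^ 2 / r ≠ 0 ∧
    bary A B C p q r ∈ L ∧
    S = bary A B C (dist B C ^ 2 / p) (dist C A ^ 2 / q) (dist A B ^ 2 / r)}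

/-- Direction of the internal bisector of the angle at `A` in triangle `ABC`
(sum of the unit vectors toward the other two vertices). -/
def intBisDir (A B C : Pt) : Pt := (dist A B)⁻¹ • (B - A) + (dist A C)⁻¹ • (C - A)

/-- A circle is tangent to a line: they touch at a point and the line does not
enter the interior of the circle. -/
def TangentLine (s : Sphere Pt) (L : AffineSubspace ℝ Pt) : Prop :=
  ∃ p, p ∈ L ∧ p ∈ s ∧ ∀ q ∈ L, s.radius ≤ dist s.center q

/-- Two circles are tangent at a point `p`: `p` lies on both and is collinear with the centers. -/
def TangentAt (s t : Sphere Pt) (p : Pt) : Prop :=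
  p ∈ s ∧ p ∈ t ∧ Collinear ℝ ({s.center, t.center, p} : Set Pt)

/-- The tripolar (trilinear polar) of the point with barycentrics `(u : v : w)`,
as the set of points with barycentrics `(x:y:z)` satisfying `x/u + y/v + z/w = 0`. -/
def tripolarSet (A B C : Pt) (u v w : ℝ) : Set Pt :=
  {S | ∃ x y z : ℝ, x + y + z ≠ 0 ∧ S = bary A B C x y z ∧ x / u + y / v + z / w = 0}

/-- `(P, Q; R, S) = -1`: the four collinear points form a harmonic range. -/
def Harmonic (P Q R S : Pt) : Prop := ∃ k : ℝ, P - R = k • (Q - R) ∧ P - S = -k • (Q - S)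

lemma bary_rotate (A B C : Pt) (x y z : ℝ) : bary A B C x y z = bary B C A y z x := by
  unfold bary
  rw [show x + y + z = y + z + x by ring,
    show x • A + y • B + z • C = y • B + z • C + x • A by abel]

lemma dist_sq_coord (P Q : Pt) : dist P Q ^ 2 = (P 0 - Q 0) ^ 2 + (P 1 - Q 1) ^ 2 := by
  rw [EuclideanSpace.dist_eq, Real.sq_sqrt (by positivity)]
  simp [Fin.sum_univ_two, Real.dist_eq, sq_abs]

lemma bary_apply (A B C : Pt) (x y z : ℝ) (i : Fin 2) :
    bary A B C x y z i = (x * A i + y * B i + z * C i) / (x + y + z) := by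
  simp [bary, div_eq_inv_mul, mul_add]

/-- The squared distance between two points in terms of their barycentric coordinates. -/
lemma dist_bary_sq (A B C : Pt) {x y z x' y' z' : ℝ} (h : x + y + z ≠ 0) (h' : x' + y' + z' ≠ 0) :
    dist (bary A B C x y z) (bary A B C x' y' z') ^ 2 =
      -(dist B C ^ 2 * (y / (x + y + z) - y' / (x' + y' + z')) *
          (z / (x + y + z) - z' / (x' + y' + z')) +
        dist C A ^ 2 * (z / (x + y + z) - z' / (x' + y' + z')) *
          (x / (x + y + z) - x' / (x' + y' + z')) +
        dist A B ^ 2 * (x / (x + y + z) - x' / (x' + y' + z')) *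
          (y / (x + y + z) - y' / (x' + y' + z'))) := by
  have e : x / (x + y + z) = 1 - y / (x + y + z) - z / (x + y + z) := by
    field_simp; ring
  have e' : x' / (x' + y' + z') = 1 - y' / (x' + y' + z') - z' / (x' + y' + z') := by
    field_simp; ring
  simp only [dist_sq_coord, bary_apply, add_div, mul_div_right_comm]
  rw [e, e']
  ring

lemma bary_snd (A B C : Pt) : bary A B C 0 1 0 = B := by simp [bary]

lemma bary_trd (A B C : Pt) : bary A B C 0 0 1 = C := by simp [bary]

lemma affineIndependent_rotate {A B C : Pt} (h : AffineIndependent ℝ ![A, B, C]) :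
    AffineIndependent ℝ ![B, C, A] := by
  convert h.comp_embedding (finRotate 3).toEmbedding using 1
  ext i : 1
  fin_cases i <;> rfl

lemma det_ne_zero_of_affineIndependent {A B C : Pt} (h : AffineIndependent ℝ ![A, B, C]) :
    (B 0 - A 0) * (C 1 - A 1) - (B 1 - A 1) * (C 0 - A 0) ≠ 0 := by
  intro hD
  rw [affineIndependent_iff] at h
  have key : ∀ p q : ℝ, (∀ i, p * (B i - A i) + q * (C i - A i) = 0) → p = 0 ∧ q = 0 := by
    intro p q hpq
    have := h Finset.univ ![-p - q, p, q] (by simp [Fin.sum_univ_three]; ring) (by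
      ext i
      have := hpq i
      simp [Fin.sum_univ_three]
      linarith)
    exact ⟨by simpa using this 1 (by simp), by simpa using this 2 (by simp)⟩
  have h1 := key (C 1 - A 1) (-(B 1 - A 1)) (by
    intro i; fin_cases i
    · simp; linarith
    · simp; ring)
  have h0 := key (C 0 - A 0) (-(B 0 - A 0)) (by
    intro i; fin_cases i
    · simp; ring
    · simp; linarith)
  have := key 1 0 (by
    intro i; fin_cases i
    · simp; linarith [h0.2]
    · simp; linarith [h1.2])
  exact one_ne_zero this.1

/-- A point equidistant from the incenter, `B` and `C` is unique. -/
lemma eq_of_equidistant_incenter {A B C O P : Pt} (ha : 0 < dist B C) (hb : 0 < dist C A)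
    (hc : 0 < dist A B) (hD : (B 0 - A 0) * (C 1 - A 1) - (B 1 - A 1) * (C 0 - A 0) ≠ 0)
    (hO : dist O (incenterPt A B C) = dist O B ∧ dist O B = dist O C)
    (hP : dist P (incenterPt A B C) ^ 2 = dist P B ^ 2 ∧ dist P B ^ 2 = dist P C ^ 2) : O = P := by
  obtain ⟨o1, o2⟩ := hO
  obtain ⟨p1, p2⟩ := hP
  replace o1 := congrArg (· ^ 2) o1
  replace o2 := congrArg (· ^ 2) o2
  set I := incenterPt A B C with hI
  have hs : dist B C + dist C A + dist A B ≠ 0 := by positivity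
  have hi : ∀ i, dist B C * (B i - A i) =
      (dist B C + dist C A + dist A B) * (B i - I i) - dist A B * (B i - C i) := by
    intro i
    rw [hI, incenterPt, bary_apply]
    field_simp
    ring
  generalize dist B C = a at *
  generalize dist C A = b at *
  rw [dist_sq_coord, dist_sq_coord] at o1 o2 p1 p2
  have q2 : (O 0 - P 0) * (B 0 - C 0) + (O 1 - P 1) * (B 1 - C 1) = 0 := by linarith
  have q3 : (O 0 - P 0) * (B 0 - I 0) + (O 1 - P 1) * (B 1 - I 1) = 0 := by linarith
  have q1 : (O 0 - P 0) * (B 0 - A 0) + (O 1 - P 1) * (B 1 - A 1) = 0 := by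
    apply mul_left_cancel₀ ha.ne'
    linear_combination (O 0 - P 0) * hi 0 + (O 1 - P 1) * hi 1 + (a + b + dist A B) * q3 -
      dist A B * q2
  have r0 : O 0 - P 0 = 0 := by
    apply (mul_eq_zero.1 _).resolve_right hD
    linear_combination (C 1 - A 1) * q1 - (B 1 - A 1) * (q1 - q2)
  have r1 : O 1 - P 1 = 0 := by
    apply (mul_eq_zero.1 _).resolve_right hD
    linear_combination (B 0 - A 0) * (q1 - q2) - (C 0 - A 0) * q1
  ext i
  fin_cases i
  · exact sub_eq_zero.1 r0
  · exact sub_eq_zero.1 r1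

/-- Barycentric coordinates with respect to `ABC` of the symmedian point of `IBC`, where `q` and
`r` are the squared distances of the incenter from `C` and `B`. -/
lemma bary_incenterPt_apply (A B C : Pt) (q r : ℝ) (ha : 0 < dist B C) (hb : 0 < dist C A)
    (hc : 0 < dist A B)
    (hq : q = dist B C * dist C A * (dist B C + dist C A - dist A B) /
      (dist B C + dist C A + dist A B))
    (hr : r = dist A B * dist B C * (dist A B + dist B C - dist C A) /
      (dist B C + dist C A + dist A B)) (i : Fin 2) :
    bary (incenterPt A B C) B C (dist B C ^ 2) q r i =
      bary A B C (dist B C ^ 2) (dist C A * (2 * dist B C + dist C A - dist A B))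
        (dist A B * (2 * dist B C + dist A B - dist C A)) i := by
  simp only [incenterPt, bary_apply]
  generalize dist B C = a at *
  generalize dist C A = b at *
  generalize dist A B = c at *
  have hSK : a ^ 2 + b * (2 * a + b - c) + c * (2 * a + c - b) ≠ 0 := by
    nlinarith [sq_nonneg (b - c), mul_pos ha hb, mul_pos ha hc, mul_pos ha ha]
  have hsum : a ^ 2 + q + r =
      a / (a + b + c) * (a ^ 2 + b * (2 * a + b - c) + c * (2 * a + c - b)) := by
    rw [hq, hr]
    field_simp
    ring
  rw [hsum, hq, hr]
  field_simp
  ring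

/-- The Brocard axis of the triangle `IBC` passes through `X₅₈`. -/
lemma X58_mem_brocardAxis {A B C O : Pt} (hABC : AffineIndependent ℝ ![A, B, C])
    (hO : dist O (incenterPt A B C) = dist O B ∧ dist O B = dist O C) :
    bary A B C (dist B C ^ 2 / (dist C A + dist A B)) (dist C A ^ 2 / (dist A B + dist B C))
      (dist A B ^ 2 / (dist B C + dist C A)) ∈
    line[ℝ, O, bary (incenterPt A B C) B C (dist B C ^ 2) (dist C (incenterPt A B C) ^ 2)
      (dist (incenterPt A B C) B ^ 2)] := by
  have hD := det_ne_zero_of_affineIndependent hABC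
  have ha : 0 < dist B C := dist_pos.2 (hABC.injective.ne (show (1 : Fin 3) ≠ 2 by decide))
  have hb : 0 < dist C A := dist_pos.2 (hABC.injective.ne (show (2 : Fin 3) ≠ 0 by decide))
  have hc : 0 < dist A B := dist_pos.2 (hABC.injective.ne (show (0 : Fin 3) ≠ 1 by decide))
  have hs : dist B C + dist C A + dist A B ≠ 0 := by positivity
  have hS : -dist B C ^ 2 + dist C A * (dist C A + dist A B) + dist A B * (dist C A + dist A B)
      ≠ 0 := by
    intro h
    apply hD
    have e1 := dist_sq_coord B C
    have e2 := dist_sq_coord C A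
    have e3 := dist_sq_coord A B
    have hdet : 4 * ((B 0 - A 0) * (C 1 - A 1) - (B 1 - A 1) * (C 0 - A 0)) ^ 2 =
        4 * dist C A ^ 2 * dist A B ^ 2 - (dist C A ^ 2 + dist A B ^ 2 - dist B C ^ 2) ^ 2 := by
      rw [e1, e2, e3]; ring
    have hsq : ((B 0 - A 0) * (C 1 - A 1) - (B 1 - A 1) * (C 0 - A 0)) ^ 2 = 0 := by
      linear_combination hdet / 4 + (2 * dist C A * dist A B -
        (dist C A ^ 2 + dist A B ^ 2 - dist B C ^ 2)) / 4 * h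
    exact (pow_eq_zero_iff two_ne_zero).1 hsq
  have hIB : dist (incenterPt A B C) B ^ 2 = dist A B * dist B C *
      (dist A B + dist B C - dist C A) / (dist B C + dist C A + dist A B) := by
    have := dist_bary_sq A B C hs (show (0 : ℝ) + 1 + 0 ≠ 0 by norm_num)
    rw [bary_snd] at this
    rw [incenterPt, this]
    field_simp
    ring
  have hIC : dist C (incenterPt A B C) ^ 2 = dist B C * dist C A *
      (dist B C + dist C A - dist A B) / (dist B C + dist C A + dist A B) := by
    have := dist_bary_sq A B C hs (show (0 : ℝ) + 0 + 1 ≠ 0 by norm_num)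
    rw [bary_trd] at this
    rw [dist_comm, incenterPt, this]
    field_simp
    ring
  have hOP : O = bary A B C (-dist B C ^ 2) (dist C A * (dist C A + dist A B))
      (dist A B * (dist C A + dist A B)) := by
    refine eq_of_equidistant_incenter ha hb hc hD hO ?_
    have dI := dist_bary_sq A B C hS hs
    have dB := dist_bary_sq A B C hS (show (0 : ℝ) + 1 + 0 ≠ 0 by norm_num)
    have dC := dist_bary_sq A B C hS (show (0 : ℝ) + 0 + 1 ≠ 0 by norm_num)
    rw [bary_snd] at dB
    rw [bary_trd] at dC
    rw [incenterPt, dI, dB, dC]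
    constructor <;> field_simp <;> ring
  have hK := bary_incenterPt_apply A B C (dist C (incenterPt A B C) ^ 2)
    (dist (incenterPt A B C) B ^ 2) ha hb hc hIC hIB
  rw [hOP]
  generalize bary (incenterPt A B C) B C (dist B C ^ 2) (dist C (incenterPt A B C) ^ 2)
    (dist (incenterPt A B C) B ^ 2) = K at *
  clear hIB hIC hOP hO hD
  generalize dist B C = a at *
  generalize dist C A = b at *
  generalize dist A B = c at *
  have hSK : a ^ 2 + b * (2 * a + b - c) + c * (2 * a + c - b) ≠ 0 := by
    nlinarith [sq_nonneg (b - c), mul_pos ha hb, mul_pos ha hc, mul_pos ha ha]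
  have hT : a ^ 2 * (c + a) * (a + b) + b ^ 2 * (b + c) * (a + b) + c ^ 2 * (b + c) * (c + a)
      ≠ 0 := by positivity
  have hX : a ^ 2 / (b + c) + b ^ 2 / (c + a) + c ^ 2 / (a + b) ≠ 0 := by positivity
  have hXeq : ∀ i, bary A B C (a ^ 2 / (b + c)) (b ^ 2 / (c + a)) (c ^ 2 / (a + b)) i =
      (a ^ 2 * (c + a) * (a + b) * A i + b ^ 2 * (b + c) * (a + b) * B i +
        c ^ 2 * (b + c) * (c + a) * C i) /
      (a ^ 2 * (c + a) * (a + b) + b ^ 2 * (b + c) * (a + b) + c ^ 2 * (b + c) * (c + a)) := by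
    intro i
    rw [bary_apply, div_eq_div_iff hX hT]
    field_simp
  convert AffineMap.lineMap_mem_affineSpan_pair
    ((b + c) * (a + b + c) / 2 * (a ^ 2 + b * (2 * a + b - c) + c * (2 * a + c - b)) /
      (a ^ 2 * (c + a) * (a + b) + b ^ 2 * (b + c) * (a + b) + c ^ 2 * (b + c) * (c + a)))
    _ _ using 1
  ext i
  rw [hXeq]
  simp only [AffineMap.lineMap_apply, vsub_eq_sub, vadd_eq_add, PiLp.add_apply, PiLp.smul_apply,
    PiLp.sub_apply, smul_eq_mul, hK, bary_apply]
  generalize hk : a ^ 2 + b * (2 * a + b - c) + c * (2 * a + c - b) = k at *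
  generalize ht : a ^ 2 * (c + a) * (a + b) + b ^ 2 * (b + c) * (a + b) +
    c ^ 2 * (b + c) * (c + a) = t at *
  generalize hσ : -a ^ 2 + b * (b + c) + c * (b + c) = σ at *
  field_simp
  subst hk ht hσ
  ring

/-- The Brocard axes of the triangles `IBC`, `ICA`, `IAB` all pass through the
Kimberling center `X₅₈ = (a²/(b+c) : b²/(c+a) : c²/(a+b))` of triangle `ABC`. -/
theorem stmt_16
    (A B C : Pt) (hABC : AffineIndependent ℝ ![A, B, C])
    (hne : ¬(dist A B = dist B C ∧ dist B C = dist C A))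
    (a b c : ℝ) (ha : a = dist B C) (hb : b = dist C A) (hc : c = dist A B)
    (I : Pt) (hI : I = incenterPt A B C)
    (X58 : Pt) (hX58 : X58 = bary A B C (a^2/(b+c)) (b^2/(c+a)) (c^2/(a+b)))
    -- circumcenters and symmedian points of the triangles IBC, ICA, IAB
    (O₁ O₂ O₃ K₁ K₂ K₃ : Pt)
    (hO₁ : dist O₁ I = dist O₁ B ∧ dist O₁ B = dist O₁ C)
    (hK₁ : K₁ = bary I B C (dist B C ^ 2) (dist C I ^ 2) (dist I B ^ 2))
    (hO₂ : dist O₂ I = dist O₂ C ∧ dist O₂ C = dist O₂ A)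
    (hK₂ : K₂ = bary I C A (dist C A ^ 2) (dist A I ^ 2) (dist I C ^ 2))
    (hO₃ : dist O₃ I = dist O₃ A ∧ dist O₃ A = dist O₃ B)
    (hK₃ : K₃ = bary I A B (dist A B ^ 2) (dist B I ^ 2) (dist I A ^ 2)) :
    X58 ∈ line[ℝ, O₁, K₁] ∧ X58 ∈ line[ℝ, O₂, K₂] ∧ X58 ∈ line[ℝ, O₃, K₃] := by
  subst ha hb hc hI hX58 hK₁ hK₂ hK₃
  have hBCA : AffineIndependent ℝ ![B, C, A] := affineIndependent_rotate hABC
  have hBC : incenterPt B C A = incenterPt A B C := (bary_rotate _ _ _ _ _ _).symm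
  have hCA : incenterPt C A B = incenterPt A B C := bary_rotate _ _ _ _ _ _
  refine ⟨X58_mem_brocardAxis hABC hO₁, ?_, ?_⟩
  · have := X58_mem_brocardAxis (O := O₂) hBCA (by rwa [hBC])
    rwa [hBC, ← bary_rotate A B C] at this
  · have := X58_mem_brocardAxis (O := O₃) (affineIndependent_rotate hBCA) (by rwa [hCA])
    rwa [hCA, bary_rotate C A B] at this
end
end

section
/- Let ABC be a triangle with incenter I and incircle of radius r touching BC, CA, AB at D, E, F, and let A₁, B₁, C₁ be the midpoints of EF, FD, DE (so that A₁B₁C₁ is the image of ABC under the inversion with center I and power r²). Let X, Y, Z be the feet of the internal bisectors of angles ∠A, ∠B, ∠C. Then the images X₁, Y₁, Z₁ of X, Y, Z under this inversion are the reflections of the vertices A₁, B₁, C₁ of triangle A₁B₁C₁ in its opposite sidelines B₁C₁, C₁A₁, A₁B₁ respectively; moreover I is the orthocenter of triangle A₁B₁C₁. -/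
open EuclideanGeometry RealInnerProductSpace Real

noncomputable section

lemma inner_sub_sub_eq_dist (A B C : Pt) :
    ⟪C - B, A - B⟫ = (dist B C ^ 2 + dist A B ^ 2 - dist C A ^ 2) / 2 := by
  have h := norm_sub_sq_real (C - B) (A - B)
  rw [sub_sub_sub_cancel_right] at h
  rw [dist_comm B C, dist_eq_norm, dist_eq_norm, dist_eq_norm]
  linarith

lemma incenterPt_rotate (A B C : Pt) : incenterPt B C A = incenterPt A B C := by
  unfold incenterPt bary
  congr 1
  · congr 1; ring
  · abel

lemma incenterPt_sub (A B C : Pt) (hs : dist B C + dist C A + dist A B ≠ 0) :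
    incenterPt A B C - B = (dist B C + dist C A + dist A B)⁻¹ •
      (dist B C • (A - B) + dist A B • (C - B)) := by
  unfold incenterPt bary
  match_scalars <;> field_simp
  ring

/-- The touch point of the incircle with `BC` divides `BC` in the ratio `(s - b) : (s - c)`. -/
lemma touch_point_sub (A B C D : Pt) (ha : 0 < dist B C) (hD₁ : D ∈ line[ℝ, B, C])
    (hD₂ : ⟪D - incenterPt A B C, C - B⟫ = 0) :
    D - B = ((dist B C + dist A B - dist C A) / (2 * dist B C)) • (C - B) := by
  obtain ⟨t, rfl⟩ := mem_affineSpan_pair_iff_exists_lineMap_eq.1 hD₁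
  have hs : 0 < dist B C + dist C A + dist A B := by
    linarith [dist_nonneg (x := C) (y := A), dist_nonneg (x := A) (y := B)]
  have hv := inner_sub_sub_eq_dist A B C
  have hu : ⟪C - B, C - B⟫ = dist B C ^ 2 := by
    rw [real_inner_self_eq_norm_sq, dist_comm, dist_eq_norm]
  rw [← sub_sub_sub_cancel_right _ _ B, incenterPt_sub A B C hs.ne'] at hD₂
  have hl : AffineMap.lineMap B C t - B = t • (C - B) := by
    simp [AffineMap.lineMap_apply]
  rw [hl] at hD₂ ⊢
  simp only [inner_sub_left, inner_add_left, inner_smul_left, real_inner_comm (C - B) (A - B),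
    hu, hv, conj_trivial] at hD₂
  congr 1
  generalize dist B C = a at *
  generalize dist C A = b at *
  generalize dist A B = c at *
  field_simp at hD₂ ⊢
  have h : (a * (a + b + c)) * (t * a * 2 - (a + c - b)) = 0 := by linear_combination hD₂
  exact sub_eq_zero.1 ((mul_eq_zero.1 h).resolve_left (mul_pos ha hs).ne')

lemma norm_touch_point_sub_sq (A B C D : Pt) (ha : 0 < dist B C)
    (hD : D - B = ((dist B C + dist A B - dist C A) / (2 * dist B C)) • (C - B)) :
    ‖D - incenterPt A B C‖ ^ 2 = (dist C A + dist A B - dist B C) *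
      (dist A B + dist B C - dist C A) * (dist B C + dist C A - dist A B) /
      (4 * (dist B C + dist C A + dist A B)) := by
  have hs : 0 < dist B C + dist C A + dist A B := by
    linarith [dist_nonneg (x := C) (y := A), dist_nonneg (x := A) (y := B)]
  have hv := inner_sub_sub_eq_dist A B C
  have hu : ⟪C - B, C - B⟫ = dist B C ^ 2 := by
    rw [real_inner_self_eq_norm_sq, dist_comm, dist_eq_norm]
  have hw : ⟪A - B, A - B⟫ = dist A B ^ 2 := by
    rw [real_inner_self_eq_norm_sq, dist_eq_norm]
  rw [← sub_sub_sub_cancel_right _ _ B, incenterPt_sub A B C hs.ne', hD,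
    ← real_inner_self_eq_norm_sq]
  generalize C - B = u at *
  generalize A - B = v at *
  simp only [inner_sub_left, inner_add_left, inner_smul_left, inner_sub_right, inner_add_right,
    inner_smul_right, real_inner_comm u v, hu, hv, hw, conj_trivial]
  generalize dist B C = a at *
  generalize dist C A = b at *
  generalize dist A B = c at *
  field_simp
  ring

lemma norm_incenterPt_sub_sq (A B C : Pt) (hs : dist B C + dist C A + dist A B ≠ 0) :
    ‖incenterPt A B C - B‖ ^ 2 = dist B C * dist A B * (dist A B + dist B C - dist C A) /
      (dist B C + dist C A + dist A B) := by
  have hv := inner_sub_sub_eq_dist A B C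
  have hu : ⟪C - B, C - B⟫ = dist B C ^ 2 := by
    rw [real_inner_self_eq_norm_sq, dist_comm, dist_eq_norm]
  have hw : ⟪A - B, A - B⟫ = dist A B ^ 2 := by
    rw [real_inner_self_eq_norm_sq, dist_eq_norm]
  rw [incenterPt_sub A B C hs, ← real_inner_self_eq_norm_sq]
  generalize C - B = u at *
  generalize A - B = v at *
  simp only [inner_add_left, inner_smul_left, inner_add_right,
    inner_smul_right, real_inner_comm u v, hu, hv, hw, conj_trivial]
  generalize dist B C = a at *
  generalize dist C A = b at *
  generalize dist A B = c at *
  field_simp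
  ring

lemma dist_lt_add_of_affineIndependent {A B C : Pt} (h : AffineIndependent ℝ ![A, B, C]) :
    dist B C < dist C A + dist A B := by
  rw [affineIndependent_iff_not_collinear_set] at h
  refine lt_of_le_of_ne (by linarith [dist_triangle B A C, dist_comm A B, dist_comm A C])
    fun he => h ?_
  have hw : Wbtw ℝ B A C := by
    rw [← dist_add_dist_eq_iff, dist_comm B A, dist_comm A C]
    linarith
  rw [Set.insert_comm]
  exact hw.collinear

lemma inner_sub_midpoint_midpoint (I D E F : Pt) (h : ‖E - I‖ = ‖F - I‖) :
    ⟪I - midpoint ℝ E F, midpoint ℝ F D - midpoint ℝ D E⟫ = 0 := by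
  have h₁ : I - midpoint ℝ E F = (-1 / 2 : ℝ) • ((E - I) + (F - I)) := by
    rw [midpoint_eq_smul_add, invOf_eq_inv]
    module
  have h₂ : midpoint ℝ F D - midpoint ℝ D E = (-1 / 2 : ℝ) • ((E - I) - (F - I)) := by
    rw [midpoint_eq_smul_add, midpoint_eq_smul_add, invOf_eq_inv]
    module
  rw [h₁, h₂, inner_smul_left, inner_smul_right,
    (real_inner_add_sub_eq_zero_iff (E - I) (F - I)).2 h]
  simp

/-- The image of the foot of the bisector from `A` under inversion in the incircle. -/
lemma inversion_bisector_foot_sub (A B C D E F : Pt) (hABC : AffineIndependent ℝ ![A, B, C])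
    (hE : E - C = ((dist C A + dist B C - dist A B) / (2 * dist C A)) • (A - C))
    (hF : F - A = ((dist A B + dist C A - dist B C) / (2 * dist A B)) • (B - A))
    (hD : ‖D - incenterPt A B C‖ = ‖E - incenterPt A B C‖) :
    inversion (incenterPt A B C) (dist (incenterPt A B C) D)
        (bary A B C 0 (dist C A) (dist A B)) - incenterPt A B C =
      (-(dist C A + dist A B) / (2 * dist B C)) •
        ((E - incenterPt A B C) + (F - incenterPt A B C)) := by
  have hBCA := affineIndependent_rotate hABC
  have hCAB := affineIndependent_rotate hBCA
  have h₁ := dist_lt_add_of_affineIndependent hABC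
  have h₂ := dist_lt_add_of_affineIndependent hBCA
  have h₃ := dist_lt_add_of_affineIndependent hCAB
  have ha : 0 < dist B C := by linarith
  have hb : 0 < dist C A := by linarith
  have hc : 0 < dist A B := by linarith
  have hs : dist A B + dist B C + dist C A ≠ 0 := by linarith
  have hr := norm_touch_point_sub_sq B C A E hb hE
  have hn := norm_incenterPt_sub_sq C A B hs
  have hIA := incenterPt_sub C A B hs
  rw [incenterPt_rotate] at hr
  rw [← incenterPt_rotate C A B] at hn hIA
  have hXI : bary A B C 0 (dist C A) (dist A B) - incenterPt A B C =
      (dist B C / (dist C A + dist A B)) • (incenterPt A B C - A) := by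
    unfold incenterPt bary
    match_scalars <;> field_simp <;> ring
  have hEF : (E - incenterPt A B C) + (F - incenterPt A B C) =
      (-((dist A B + dist B C - dist C A) * (dist B C + dist C A - dist A B)) /
        (2 * dist C A * dist A B)) • (incenterPt A B C - A) := by
    have h : (E - incenterPt A B C) + (F - incenterPt A B C) =
        (E - C) + (C - A) + (F - A) - (2 : ℝ) • (incenterPt A B C - A) := by module
    rw [h, hE, hF, hIA]
    match_scalars <;> field_simp <;> ring
  rw [inversion, vsub_eq_sub, vadd_eq_add, add_sub_cancel_right, hXI, hEF, smul_smul, smul_smul]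
  congr 1
  rw [div_pow, dist_eq_norm _ (incenterPt A B C), hXI, dist_comm, dist_eq_norm, hD, hr, norm_smul,
    mul_pow, hn, Real.norm_eq_abs, sq_abs]
  have h₄ : dist C A + dist A B - dist B C ≠ 0 := by linarith
  generalize dist B C = a at *
  generalize dist C A = b at *
  generalize dist A B = c at *
  field_simp
  ring

lemma midpoint_mem_line_and_inner_eq_zero (I D E F P : Pt) (a b c : ℝ) (ha : a ≠ 0)
    (h : a • (D - I) + b • (E - I) + c • (F - I) = 0) (hEF : ‖E - I‖ = ‖F - I‖)
    (hP : P - I = (-(b + c) / (2 * a)) • ((E - I) + (F - I))) :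
    midpoint ℝ P (midpoint ℝ E F) ∈ line[ℝ, midpoint ℝ F D, midpoint ℝ D E] ∧
      ⟪P - midpoint ℝ E F, midpoint ℝ D E - midpoint ℝ F D⟫ = 0 := by
  have hP' : P = I + (-(b + c) / (2 * a)) • ((E - I) + (F - I)) := by rw [← hP]; abel
  have hD : D = I - (b / a) • (E - I) - (c / a) • (F - I) := by
    have h' : D = I - (b / a) • (E - I) - (c / a) • (F - I) +
        a⁻¹ • (a • (D - I) + b • (E - I) + c • (F - I)) := by
      match_scalars <;> field_simp <;> ring
    rwa [h, smul_zero, add_zero] at h'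
  constructor
  · rw [mem_affineSpan_pair_iff_exists_lineMap_eq]
    refine ⟨(a + b - c) / (2 * a), ?_⟩
    simp only [AffineMap.lineMap_apply, vsub_eq_sub, vadd_eq_add, midpoint_eq_smul_add,
      invOf_eq_inv]
    rw [hP', hD]
    match_scalars <;> field_simp <;> ring
  · have h₁ : P - midpoint ℝ E F = (1 + (b + c) / a) • (I - midpoint ℝ E F) := by
      rw [hP', midpoint_eq_smul_add, invOf_eq_inv]
      match_scalars <;> field_simp <;> ring
    rw [h₁, inner_smul_left, ← neg_sub (midpoint ℝ F D), inner_neg_right,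
      inner_sub_midpoint_midpoint I D E F hEF, neg_zero, mul_zero]

/-- The unit normals of a triangle, weighted by the side lengths, sum to zero. -/
lemma sum_side_smul_touch_point_sub (A B C D E F : Pt)
    (ha : 0 < dist B C) (hb : 0 < dist C A) (hc : 0 < dist A B)
    (hD : D - B = ((dist B C + dist A B - dist C A) / (2 * dist B C)) • (C - B))
    (hE : E - C = ((dist C A + dist B C - dist A B) / (2 * dist C A)) • (A - C))
    (hF : F - A = ((dist A B + dist C A - dist B C) / (2 * dist A B)) • (B - A)) :
    dist B C • (D - incenterPt A B C) + dist C A • (E - incenterPt A B C) +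
      dist A B • (F - incenterPt A B C) = 0 := by
  rw [← sub_add_sub_cancel D B, ← sub_add_sub_cancel E C, ← sub_add_sub_cancel F A, hD, hE, hF]
  unfold incenterPt bary
  match_scalars <;> field_simp <;> ring

/-- Under the inversion with center `I` and power `r²`, the images `X₁, Y₁, Z₁`
of the internal bisector feet `X, Y, Z` are the reflections of the vertices `A₁, B₁, C₁` of the
inverted triangle in its opposite sidelines (i.e. the midpoint of `X₁A₁` lies on `B₁C₁` and
`X₁A₁ ⊥ B₁C₁`, etc.), and `I` is the orthocenter of triangle `A₁B₁C₁`. -/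
theorem stmt_18
    (A B C : Pt) (hABC : AffineIndependent ℝ ![A, B, C])
    (a b c : ℝ) (ha : a = dist B C) (hb : b = dist C A) (hc : c = dist A B)
    (I : Pt) (hI : I = incenterPt A B C)
    (D E F : Pt)
    (hD₁ : D ∈ line[ℝ, B, C]) (hD₂ : ⟪D - I, C - B⟫ = 0)
    (hE₁ : E ∈ line[ℝ, C, A]) (hE₂ : ⟪E - I, A - C⟫ = 0)
    (hF₁ : F ∈ line[ℝ, A, B]) (hF₂ : ⟪F - I, B - A⟫ = 0)
    (r : ℝ) (hr : r = dist I D)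
    (A₁ B₁ C₁ : Pt)
    (hA₁ : A₁ = midpoint ℝ E F) (hB₁ : B₁ = midpoint ℝ F D) (hC₁ : C₁ = midpoint ℝ D E)
    (X Y Z : Pt)
    (hX : X = bary A B C 0 b c) (hY : Y = bary A B C a 0 c) (hZ : Z = bary A B C a b 0)
    (X₁ Y₁ Z₁ : Pt)
    (hX₁ : X₁ = EuclideanGeometry.inversion I r X)
    (hY₁ : Y₁ = EuclideanGeometry.inversion I r Y)
    (hZ₁ : Z₁ = EuclideanGeometry.inversion I r Z) :
    (midpoint ℝ X₁ A₁ ∈ line[ℝ, B₁, C₁] ∧ ⟪X₁ - A₁, C₁ - B₁⟫ = 0) ∧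
    (midpoint ℝ Y₁ B₁ ∈ line[ℝ, C₁, A₁] ∧ ⟪Y₁ - B₁, A₁ - C₁⟫ = 0) ∧
    (midpoint ℝ Z₁ C₁ ∈ line[ℝ, A₁, B₁] ∧ ⟪Z₁ - C₁, B₁ - A₁⟫ = 0) ∧
    (⟪I - A₁, B₁ - C₁⟫ = 0 ∧ ⟪I - B₁, C₁ - A₁⟫ = 0) := by
  have hBCA := affineIndependent_rotate hABC
  have hCAB := affineIndependent_rotate hBCA
  have h₁ := dist_lt_add_of_affineIndependent hABC
  have h₂ := dist_lt_add_of_affineIndependent hBCA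
  have h₃ := dist_lt_add_of_affineIndependent hCAB
  have ha₀ : 0 < dist B C := by linarith
  have hb₀ : 0 < dist C A := by linarith
  have hc₀ : 0 < dist A B := by linarith
  have hIB : incenterPt B C A = incenterPt A B C := incenterPt_rotate A B C
  have hIC : incenterPt C A B = incenterPt A B C := by rw [incenterPt_rotate, incenterPt_rotate]
  subst ha hb hc hI hr hA₁ hB₁ hC₁ hX hY hZ hX₁ hY₁ hZ₁
  have hD := touch_point_sub A B C D ha₀ hD₁ hD₂
  have hE := touch_point_sub B C A E hb₀ hE₁ (by rwa [hIB])
  have hF := touch_point_sub C A B F hc₀ hF₁ (by rwa [hIC])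
  have nD := norm_touch_point_sub_sq A B C D ha₀ hD
  have nE := norm_touch_point_sub_sq B C A E hb₀ hE
  have nF := norm_touch_point_sub_sq C A B F hc₀ hF
  rw [hIB] at nE
  rw [hIC] at nF
  have hDE : ‖D - incenterPt A B C‖ = ‖E - incenterPt A B C‖ := by
    rw [← sq_eq_sq₀ (norm_nonneg _) (norm_nonneg _), nD, nE]
    ring
  have hEF : ‖E - incenterPt A B C‖ = ‖F - incenterPt A B C‖ := by
    rw [← sq_eq_sq₀ (norm_nonneg _) (norm_nonneg _), nE, nF]
    ring
  have hsum := sum_side_smul_touch_point_sub A B C D E F ha₀ hb₀ hc₀ hD hE hF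
  have hX := inversion_bisector_foot_sub A B C D E F hABC hE hF hDE
  have hY := inversion_bisector_foot_sub B C A E F D hBCA hF hD (by rwa [hIB])
  have hZ := inversion_bisector_foot_sub C A B F D E hCAB hD hE (by rw [hIC, ← hEF, hDE])
  have hdE : dist (incenterPt A B C) E = dist (incenterPt A B C) D := by
    rw [dist_comm, dist_eq_norm, ← hDE, dist_comm, dist_eq_norm]
  have hdF : dist (incenterPt A B C) F = dist (incenterPt A B C) D := by
    rw [dist_comm, dist_eq_norm, ← hEF, ← hDE, dist_comm, dist_eq_norm]
  have hYb : bary B C A 0 (dist A B) (dist B C) = bary A B C (dist B C) 0 (dist A B) := by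
    unfold bary
    congr 1
    · congr 1; ring
    · abel
  have hZb : bary C A B 0 (dist B C) (dist C A) = bary A B C (dist B C) (dist C A) 0 := by
    unfold bary
    congr 1
    · congr 1; ring
    · abel
  rw [hIB, hYb, hdE] at hY
  rw [hIC, hZb, hdF] at hZ
  refine ⟨midpoint_mem_line_and_inner_eq_zero _ D E F _ _ _ _ ha₀.ne' hsum hEF hX,
    midpoint_mem_line_and_inner_eq_zero _ E F D _ _ _ _ hb₀.ne' ?_ (hEF.symm.trans hDE.symm) hY,
    midpoint_mem_line_and_inner_eq_zero _ F D E _ _ _ _ hc₀.ne' ?_ hDE hZ,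
    inner_sub_midpoint_midpoint _ D E F hEF,
    inner_sub_midpoint_midpoint _ E F D (hEF.symm.trans hDE.symm)⟩
  · rw [← hsum]; abel
  · rw [← hsum]; abel
end
end
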